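/- arXiv:1312.6275 — 2 statements merged into one kernel-verified Lean document; each statement's English description precedes it below -/
import Mathlib

section
/- For every z ∈ K and i ∈ {1,2}, the quantity 𝔼_z[|f_i·S(τ)| e^{a(c_i)·S(τ)}; τ < ∞] is finite; in particular z ↦ 𝔼_z[f_i·S(τ) e^{a(c_i)·S(τ)}; τ < ∞] is a well-defined finite function on K. -/
open scoped ENNReal Classical

noncomputable section

namespace KilledRW

/-- The two-dimensional integer lattice. -/
abbrev Z2 := ℤ × ℤ

/-- The plane `ℝ²`. -/
abbrev R2 := ℝ × ℝ

/-- Euclidean dot product on `ℝ²`. -/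
def dotR (a b : R2) : ℝ := a.1 * b.1 + a.2 * b.2

/-- Embedding of the lattice into the plane. -/
def emb (z : Z2) : R2 := ((z.1 : ℝ), (z.2 : ℝ))

/-- Euclidean norm on `ℝ²`. -/
def nrm (x : R2) : ℝ := Real.sqrt (dotR x x)

/-- The jump generating function `φ(a) = Σ_z γ(z) e^{a·z}`. -/
def jgf (γ : Z2 → ℝ) (a : R2) : ℝ := ∑' z : Z2, γ z * Real.exp (dotR a (emb z))

/-- The gradient `∇φ(a) = Σ_z z γ(z) e^{a·z}` of the jump generating function. -/
def gradJgf (γ : Z2 → ℝ) (a : R2) : R2 :=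
  (∑' z : Z2, γ z * Real.exp (dotR a (emb z)) * (z.1 : ℝ),
   ∑' z : Z2, γ z * Real.exp (dotR a (emb z)) * (z.2 : ℝ))

/-- The normalized gradient `q(a) = ∇φ(a)/|∇φ(a)|`. -/
def qmap (γ : Z2 → ℝ) (a : R2) : R2 := (nrm (gradJgf γ a))⁻¹ • gradJgf γ a

/-- (Sub)stochastic transition kernel of the twisted random walk `S_a`:
`p_a(z,z') = γ(z'-z) e^{a·(z'-z)}`.  For `a = 0` this is the kernel of the original walk. -/
def twKer (γ : Z2 → ℝ) (a : R2) (z z' : Z2) : ℝ≥0∞ :=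
  ENNReal.ofReal (γ (z' - z) * Real.exp (dotR a (emb (z' - z))))

/-- `n`-step transition probabilities of the (sub)stochastic kernel `κ`. -/
def nstep (κ : Z2 → Z2 → ℝ≥0∞) : ℕ → Z2 → Z2 → ℝ≥0∞
  | 0, z, z' => if z' = z then 1 else 0
  | n + 1, z, z' => ∑' w : Z2, κ z w * nstep κ n w z'

/-- `exitP κ A n z z' = ℙ_z(τ_A = n, S(n) = z')`: the probability that the walk with kernel `κ`
started at `z` stays in `A` strictly before time `n` and is at `z' ∉ A` at time `n`
(where `τ_A = inf{n ≥ 0 : S(n) ∉ A}`). -/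
def exitP (κ : Z2 → Z2 → ℝ≥0∞) (A : Set Z2) : ℕ → Z2 → Z2 → ℝ≥0∞
  | 0, z, z' => if z' = z ∧ z ∉ A then 1 else 0
  | n + 1, z, z' => if z ∈ A then ∑' w : Z2, κ z w * exitP κ A n w z' else 0

/-- `aliveP κ A n z z' = ℙ_z(τ_A > n, S(n) = z')`. -/
def aliveP (κ : Z2 → Z2 → ℝ≥0∞) (A : Set Z2) : ℕ → Z2 → Z2 → ℝ≥0∞
  | 0, z, z' => if z' = z ∧ z ∈ A then 1 else 0
  | n + 1, z, z' => if z ∈ A then ∑' w : Z2, κ z w * aliveP κ A n w z' else 0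

/-- `ℙ_z(τ_A < ∞)` for the walk with kernel `κ`. -/
def exitTotal (κ : Z2 → Z2 → ℝ≥0∞) (A : Set Z2) (z : Z2) : ℝ≥0∞ :=
  ∑' n : ℕ, ∑' z' : Z2, exitP κ A n z z'

/-- `𝔼_z[g(S(τ_A)); τ_A < ∞]` for a nonnegative integrand, with values in `ℝ≥0∞`. -/
def exitLExp (κ : Z2 → Z2 → ℝ≥0∞) (A : Set Z2) (z : Z2) (g : Z2 → ℝ) : ℝ≥0∞ :=
  ∑' n : ℕ, ∑' z' : Z2, exitP κ A n z z' * ENNReal.ofReal (g z')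

/-- `𝔼_z[g(S(τ_A)); τ_A < ∞]` for a signed integrand (positive part minus negative part). -/
def exitExp (κ : Z2 → Z2 → ℝ≥0∞) (A : Set Z2) (z : Z2) (g : Z2 → ℝ) : ℝ :=
  (exitLExp κ A z g).toReal - (exitLExp κ A z fun w => -g w).toReal

/-- `𝔼_z[g(S(τ_A)); τ_A ≤ n]`, nonnegative version. -/
def exitLExpTrunc (κ : Z2 → Z2 → ℝ≥0∞) (A : Set Z2) (z : Z2) (g : Z2 → ℝ) (n : ℕ) : ℝ≥0∞ :=
  ∑ m ∈ Finset.range (n + 1), ∑' z' : Z2, exitP κ A m z z' * ENNReal.ofReal (g z')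

/-- `𝔼_z[g(S(τ_A)); τ_A ≤ n]`, signed version. -/
def exitExpTrunc (κ : Z2 → Z2 → ℝ≥0∞) (A : Set Z2) (z : Z2) (g : Z2 → ℝ) (n : ℕ) : ℝ :=
  (exitLExpTrunc κ A z g n).toReal - (exitLExpTrunc κ A z (fun w => -g w) n).toReal

/-- `𝔼_z[g(S(n)); τ_A > n]`, nonnegative version. -/
def aliveLExpAt (κ : Z2 → Z2 → ℝ≥0∞) (A : Set Z2) (z : Z2) (g : Z2 → ℝ) (n : ℕ) : ℝ≥0∞ :=
  ∑' z' : Z2, aliveP κ A n z z' * ENNReal.ofReal (g z')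

/-- `𝔼_z[g(S(n)); τ_A > n]`, signed version. -/
def aliveExpAt (κ : Z2 → Z2 → ℝ≥0∞) (A : Set Z2) (z : Z2) (g : Z2 → ℝ) (n : ℕ) : ℝ :=
  (aliveLExpAt κ A z g n).toReal - (aliveLExpAt κ A z (fun w => -g w) n).toReal

/-- A nonnegative function on `ℝ` that is superharmonic far to the right for centred random walks
with exponential moments, and that dominates the absolute value. -/
def lyap (u : ℝ) : ℝ := u + 1 - Real.exp (-u) + 3 * (if u ≤ 0 then Real.exp (-u) else 0)

theorem abs_le_lyap (u : ℝ) : |u| ≤ lyap u := by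
  unfold lyap
  have h1 := Real.add_one_le_exp (-u)
  split_ifs with h
  · rw [abs_of_nonpos h]; linarith
  · rw [abs_of_pos (not_le.1 h)]
    have : Real.exp (-u) ≤ 1 := Real.exp_le_one_iff.2 (by linarith)
    linarith

/-- For a centred nondegenerate step distribution `p` with increments `t`, `lyap` is superharmonic
on a right half-line. -/
theorem lyap_superharmonic {ι : Type*} (p t : ι → ℝ) (hp : ∀ v, 0 ≤ p v) (hp1 : HasSum p 1)
    (hpt : HasSum (fun v => p v * t v) 0) (hexp : Summable fun v => p v * Real.exp (-t v))
    (hnd : ∃ v, 0 < p v ∧ t v ≠ 0) :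
    ∃ x₀ : ℝ, 0 ≤ x₀ ∧ ∀ x, x₀ ≤ x →
      ∃ s, HasSum (fun v => p v * lyap (x + t v)) s ∧ s ≤ lyap x := by
  set ψ := ∑' v, p v * Real.exp (-t v) with hψ
  have hψ1 : 1 < ψ := by
    obtain ⟨v, hv, htv⟩ := hnd
    have h1 : HasSum (fun v => p v * (1 - t v)) 1 := by
      simpa [mul_sub] using hp1.sub hpt
    refine hasSum_lt (i := v) (fun w => ?_) ?_ h1 hexp.hasSum
    · exact mul_le_mul_of_nonneg_left (by linarith [Real.add_one_le_exp (-t w)]) (hp w)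
    · exact mul_lt_mul_of_pos_left
        (by linarith [Real.add_one_lt_exp (neg_ne_zero.2 htv)]) hv
  let T : ℝ → ι → ℝ := fun x v => if x + t v ≤ 0 then p v * Real.exp (-t v) else 0
  have hTle : ∀ x v, T x v ≤ p v * Real.exp (-t v) := fun x v => by
    have := mul_nonneg (hp v) (Real.exp_pos (-t v)).le
    simp only [T]; split_ifs <;> linarith
  have hT0 : ∀ x v, 0 ≤ T x v := fun x v => by
    have := mul_nonneg (hp v) (Real.exp_pos (-t v)).le
    simp only [T]; split_ifs <;> linarith
  have hTs : ∀ x, Summable (T x) := fun x => hexp.of_nonneg_of_le (hT0 x) (hTle x)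
  have hlim : Filter.Tendsto (fun x => ∑' v, T x v) Filter.atTop (nhds (∑' _ : ι, (0 : ℝ))) := by
    refine tendsto_tsum_of_dominated_convergence hexp (fun v => ?_)
      (Filter.Eventually.of_forall fun x v => ?_)
    · refine tendsto_const_nhds.congr' ?_
      filter_upwards [Filter.eventually_gt_atTop (-t v)] with x hx
      simp only [T]; rw [if_neg (by linarith)]
    · rw [Real.norm_of_nonneg (hT0 x v)]; exact hTle x v
  rw [tsum_zero] at hlim
  have hev := (hlim.eventually_lt_const (show (0 : ℝ) < (ψ - 1) / 3 by linarith)).and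
    (Filter.eventually_ge_atTop 0)
  obtain ⟨x₀, hx₀⟩ := Filter.eventually_atTop.1 hev
  refine ⟨x₀, (hx₀ x₀ le_rfl).2, fun x hx => ?_⟩
  have hx' := (hx₀ x hx).1
  refine ⟨x * 1 + 0 + 1 - Real.exp (-x) * ψ + 3 * Real.exp (-x) * ∑' v, T x v, ?_, ?_⟩
  · have h := ((((hp1.mul_left x).add hpt).add hp1).sub (hexp.hasSum.mul_left (Real.exp (-x)))).add
      ((hTs x).hasSum.mul_left (3 * Real.exp (-x)))
    refine h.congr_fun ?_
    intro v
    simp only [lyap, T, neg_add, Real.exp_add]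
    split_ifs <;> ring
  · have he := Real.exp_pos (-x)
    have h3 : (0 : ℝ) ≤ if x ≤ 0 then Real.exp (-x) else 0 := by split_ifs <;> positivity
    unfold lyap
    nlinarith [mul_lt_mul_of_pos_left hx' he]

/-- A nonnegative function that is superharmonic on `A` bounds the expectation at the exit time
from `A` of anything it dominates. -/
theorem exitLExp_le_of_superharmonic (κ : Z2 → Z2 → ℝ≥0∞) (A : Set Z2) (g : Z2 → ℝ)
    (H : Z2 → ℝ≥0∞) (hgH : ∀ z, ENNReal.ofReal (g z) ≤ H z)
    (hH : ∀ z ∈ A, ∑' w, κ z w * H w ≤ H z) (z : Z2) :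
    exitLExp κ A z g ≤ H z := by
  have key : ∀ N : ℕ, ∀ z, ∑ n ∈ Finset.range N,
      ∑' z', exitP κ A n z z' * ENNReal.ofReal (g z') ≤ H z := by
    intro N
    induction N with
    | zero => simp
    | succ N ih =>
      intro z
      rw [Finset.sum_range_succ']
      by_cases hz : z ∈ A
      · refine le_trans ?_ (hH z hz)
        simp only [exitP, hz, if_true, not_true_eq_false, and_false, if_false, zero_mul, tsum_zero,
          add_zero]
        calc _ = ∑ n ∈ Finset.range N, ∑' w, κ z w *
                ∑' z', exitP κ A n w z' * ENNReal.ofReal (g z') := by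
              refine Finset.sum_congr rfl fun n _ => ?_
              simp_rw [← ENNReal.tsum_mul_right, ← ENNReal.tsum_mul_left]
              rw [ENNReal.tsum_comm]
              simp_rw [mul_assoc]
          _ = ∑' w, κ z w * ∑ n ∈ Finset.range N,
                ∑' z', exitP κ A n w z' * ENNReal.ofReal (g z') := by
              simp_rw [Finset.mul_sum]
              rw [Summable.tsum_finsetSum fun _ _ => ENNReal.summable]
          _ ≤ _ := ENNReal.tsum_le_tsum fun w => mul_le_mul_right (ih w) _
      · simp only [exitP, hz, if_false, zero_mul, tsum_zero, Finset.sum_const_zero, zero_add,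
          not_false_eq_true, and_true, ite_mul, one_mul, tsum_ite_eq]
        exact hgH z
  unfold exitLExp
  rw [ENNReal.tsum_eq_iSup_nat]
  exact iSup_le fun N => key N z

theorem dotR_emb_add (b : R2) (v w : Z2) :
    dotR b (emb (v + w)) = dotR b (emb v) + dotR b (emb w) := by
  simp [dotR, emb]; ring

/-- If every possible jump is orthogonal to `b`, the walk never changes its `b`-projection. -/
theorem dotR_eq_of_nstep_pos (γ : Z2 → ℝ) (b : R2)
    (h : ∀ v, 0 < γ v → dotR b (emb v) = 0) (n : ℕ) :
    ∀ z z', 0 < nstep (twKer γ 0) n z z' → dotR b (emb z') = dotR b (emb z) := by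
  induction n with
  | zero =>
    intro z z' hpos
    by_cases hzz : z' = z
    · rw [hzz]
    · simp [nstep, hzz] at hpos
  | succ n ih =>
    intro z z' hpos
    obtain ⟨w, hw⟩ : ∃ w, twKer γ 0 z w * nstep (twKer γ 0) n w z' ≠ 0 := by
      by_contra! hcon
      simp [nstep, hcon] at hpos
    rw [ih w z' (pos_iff_ne_zero.2 (right_ne_zero_of_mul hw))]
    have hγ : 0 < γ (w - z) := by
      have := pos_iff_ne_zero.2 (left_ne_zero_of_mul hw)
      rw [twKer, ENNReal.ofReal_pos] at this
      exact pos_of_mul_pos_left this (Real.exp_pos _).le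
    have := dotR_emb_add b z (w - z)
    rw [h _ hγ, add_sub_cancel, add_zero] at this
    exact this

/-- Irreducibility forces some possible jump to have nonzero projection on a given direction. -/
theorem exists_dotR_ne_zero (γ : Z2 → ℝ) (hA1 : ∀ z z' : Z2, ∃ n, 0 < nstep (twKer γ 0) n z z')
    (b : R2) (hb : nrm b = 1) : ∃ v, 0 < γ v ∧ dotR b (emb v) ≠ 0 := by
  by_contra! h
  have hz : ∀ z, dotR b (emb z) = 0 := fun z => by
    obtain ⟨n, hn⟩ := hA1 0 z
    rw [dotR_eq_of_nstep_pos γ b h n 0 z hn]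
    simp [dotR, emb]
  have h1 : b.1 = 0 := by simpa [dotR, emb] using hz (1, 0)
  have h2 : b.2 = 0 := by simpa [dotR, emb] using hz (0, 1)
  simp [nrm, dotR, h1, h2] at hb

/-- Finiteness of the jump generating function gives first exponential moments. -/
theorem summable_exp_mul_dotR (γ : Z2 → ℝ) (hγ0 : ∀ z, 0 ≤ γ z)
    (hA3 : ∀ a : R2, Summable fun z : Z2 => γ z * Real.exp (dotR a (emb z))) (a b : R2) :
    Summable fun z : Z2 => γ z * Real.exp (dotR a (emb z)) * dotR b (emb z) := by
  refine Summable.of_norm_bounded ((hA3 (a + b)).add (hA3 (a - b))) fun z => ?_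
  have h1 : dotR (a + b) (emb z) = dotR a (emb z) + dotR b (emb z) := by simp [dotR]; ring
  have h2 : dotR (a - b) (emb z) = dotR a (emb z) + -dotR b (emb z) := by simp [dotR]; ring
  have h0 : 0 ≤ γ z * Real.exp (dotR a (emb z)) := mul_nonneg (hγ0 z) (Real.exp_pos _).le
  rw [h1, h2, Real.exp_add, Real.exp_add, norm_mul, Real.norm_of_nonneg h0, Real.norm_eq_abs,
    ← mul_assoc, ← mul_assoc, ← mul_add]
  refine mul_le_mul_of_nonneg_left (abs_le.2 ⟨?_, ?_⟩) h0 <;>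
    linarith [Real.add_one_le_exp (dotR b (emb z)), Real.add_one_le_exp (-dotR b (emb z)),
      Real.exp_pos (dotR b (emb z)), Real.exp_pos (-dotR b (emb z))]

/-- The tilted drift vanishes in directions orthogonal to `qmap γ a`. -/
theorem hasSum_exp_mul_dotR_zero (γ : Z2 → ℝ) (hγ0 : ∀ z, 0 ≤ γ z)
    (hA3 : ∀ a : R2, Summable fun z : Z2 => γ z * Real.exp (dotR a (emb z))) (a b c : R2)
    (hc : nrm c = 1) (hbc : dotR b c = 0) (haq : qmap γ a = c) :
    HasSum (fun z : Z2 => γ z * Real.exp (dotR a (emb z)) * dotR b (emb z)) 0 := by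
  have h1 := summable_exp_mul_dotR γ hγ0 hA3 a (1, 0)
  have h2 := summable_exp_mul_dotR γ hγ0 hA3 a (0, 1)
  simp only [dotR, emb, one_mul, zero_mul, add_zero, zero_add] at h1 h2
  have hgrad : b.1 * (gradJgf γ a).1 + b.2 * (gradJgf γ a).2 = 0 := by
    subst haq
    have hne : (nrm (gradJgf γ a))⁻¹ ≠ 0 := by
      intro h0
      rw [qmap, h0, zero_smul] at hc
      simp [nrm, dotR] at hc
    have : (nrm (gradJgf γ a))⁻¹ * (b.1 * (gradJgf γ a).1 + b.2 * (gradJgf γ a).2) = 0 := by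
      rw [← hbc]; simp [qmap, dotR]; ring
    exact (mul_eq_zero.1 this).resolve_left hne
  have h := (h1.hasSum.mul_left b.1).add (h2.hasSum.mul_left b.2)
  simp only [gradJgf, dotR, emb] at hgrad
  rw [hgrad] at h
  refine h.congr_fun fun z => ?_
  simp only [dotR, emb]; ring

/-- **Lemma 5.** For every `z ∈ K` and `i ∈ {1,2}`, the quantity
`𝔼_z[|fᵢ·S(τ)| e^{a(cᵢ)·S(τ)}; τ < ∞]` is finite; in particular
`z ↦ 𝔼_z[fᵢ·S(τ) e^{a(cᵢ)·S(τ)}; τ < ∞]` is a well-defined finite function on `K`. -/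
theorem exit_exp_abs_finite
    (γ : Z2 → ℝ) (c f : Fin 2 → R2) (K : Set R2)
    -- `γ` is a probability distribution on `ℤ²`
    (hγ0 : ∀ z : Z2, 0 ≤ γ z) (hγ1 : HasSum γ 1)
    -- `c 0, c 1` are unit vectors, `f i` is the unit vector perpendicular to `c i`
    -- pointing into the cone; the angle between `c 0` and `c 1` lies in `(0, π)`
    (hcUnit : ∀ i, nrm (c i) = 1) (hfUnit : ∀ i, nrm (f i) = 1)
    (hperp : ∀ i, dotR (f i) (c i) = 0)
    (hinward : ∀ i j, i ≠ j → 0 < dotR (f i) (c j))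
    -- `K` is the open convex cone bounded by the rays through `c 0` and `c 1`
    (hK : K = {x : R2 | ∀ i, 0 < dotR (f i) x})
    -- (A1) the walk is irreducible with nonzero mean
    (hA1 : ∀ z z' : Z2, ∃ n : ℕ, 0 < nstep (twKer γ 0) n z z')
    (hmean : (∑' z : Z2, γ z * (z.1 : ℝ), ∑' z : Z2, γ z * (z.2 : ℝ)) ≠ (0, 0))
    -- (A2) the walk killed when leaving `K` is irreducible in `K`
    (hA2 : ∀ z z' : Z2, emb z ∈ K → emb z' ∈ K →
        ∃ n : ℕ, 0 < aliveP (twKer γ 0) (emb ⁻¹' K) n z z')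
    -- (A3) the jump generating function is finite everywhere
    (hA3 : ∀ a : R2, Summable fun z : Z2 => γ z * Real.exp (dotR a (emb z)))
    -- (A4) the projections `fᵢ·S(n)` are aperiodic random walks
    (hA4 : ∀ i : Fin 2, ∀ d : ℕ,
        (∀ n : ℕ, 0 < n →
          0 < ∑' z : Z2, (if dotR (f i) (emb z) = 0 then nstep (twKer γ 0) n 0 z else 0) →
          d ∣ n) → d = 1)
    (z : Z2) (hz : emb z ∈ K) (i : Fin 2)
    -- `a = a(cᵢ)`
    (a : R2) (haD : jgf γ a = 1) (haq : qmap γ a = c i) :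
    exitLExp (twKer γ 0) (emb ⁻¹' K) z
        (fun z' => |dotR (f i) (emb z')| * Real.exp (dotR a (emb z'))) ≠ ⊤ := by
  have hfz : ∀ w : Z2, emb w ∈ K → 0 < dotR (f i) (emb w) := fun w hw => by
    rw [hK] at hw; exact hw i
  set p : Z2 → ℝ := fun v => γ v * Real.exp (dotR a (emb v)) with hp
  set t : Z2 → ℝ := fun v => dotR (f i) (emb v) with ht
  have hp0 : ∀ v, 0 ≤ p v := fun v => mul_nonneg (hγ0 v) (Real.exp_pos _).le
  have hp1 : HasSum p 1 := haD ▸ (hA3 a).hasSum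
  have hexp : Summable fun v => p v * Real.exp (-t v) := by
    refine (hA3 (a - f i)).congr fun v => ?_
    simp only [hp, ht]
    rw [mul_assoc, ← Real.exp_add]
    congr 2
    simp [dotR]; ring
  obtain ⟨v₀, hv₀, htv₀⟩ := exists_dotR_ne_zero γ hA1 (f i) (hfUnit i)
  obtain ⟨x₀, hx₀, hsup⟩ := lyap_superharmonic p t hp0 hp1
    (hasSum_exp_mul_dotR_zero γ hγ0 hA3 a (f i) (c i) (hcUnit i) (hperp i) haq) hexp
    ⟨v₀, mul_pos hv₀ (Real.exp_pos _), htv₀⟩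
  let H : Z2 → ℝ := fun w => (x₀ + lyap (x₀ + t w)) * Real.exp (dotR a (emb w))
  have hly : ∀ u, 0 ≤ lyap u := fun u => (abs_nonneg u).trans (abs_le_lyap u)
  refine ne_top_of_le_ne_top (ENNReal.ofReal_ne_top (r := H z))
    (exitLExp_le_of_superharmonic _ _ _ (fun w => ENNReal.ofReal (H w)) (fun w => ?_)
      (fun w hw => ?_) z)
  · refine ENNReal.ofReal_le_ofReal (mul_le_mul_of_nonneg_right ?_ (Real.exp_pos _).le)
    have h1 := abs_le_lyap (x₀ + t w)
    have h2 := abs_sub (x₀ + t w) x₀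
    rw [add_sub_cancel_left, abs_of_nonneg hx₀] at h2
    linarith
  · obtain ⟨s, hs, hsle⟩ := hsup (x₀ + t w) (by linarith [hfz w hw])
    have hsum := ((hp1.mul_left x₀).add hs).mul_left (Real.exp (dotR a (emb w)))
    rw [← (Equiv.addLeft w).tsum_eq]
    have hterm : ∀ v, twKer γ 0 w (Equiv.addLeft w v) * ENNReal.ofReal (H (Equiv.addLeft w v)) =
        ENNReal.ofReal (Real.exp (dotR a (emb w)) * (x₀ * p v + p v * lyap (x₀ + t w + t v))) := by
      intro v
      have h0 : dotR 0 (emb v) = 0 := by simp [dotR]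
      simp only [twKer, Equiv.coe_addLeft, add_sub_cancel_left, h0, Real.exp_zero, mul_one]
      rw [← ENNReal.ofReal_mul (hγ0 v)]
      simp only [H, hp, ht, dotR_emb_add, Real.exp_add, add_assoc]
      congr 1
      ring
    simp_rw [hterm]
    rw [← ENNReal.ofReal_tsum_of_nonneg _ hsum.summable, hsum.tsum_eq]
    · refine ENNReal.ofReal_le_ofReal ?_
      simp only [H]
      rw [mul_comm, mul_one]
      exact mul_le_mul_of_nonneg_right (by linarith) (Real.exp_pos _).le
    · intro v
      exact mul_nonneg (Real.exp_pos _).le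
        (add_nonneg (mul_nonneg hx₀ (hp0 v)) (mul_nonneg (hp0 v) (hly _)))

end KilledRW
end
end

section
/- For a ∈ Γ, the function z ↦ 1 − 𝔼_z[e^{a·(S(τ)−z)}; τ < ∞] on K is strictly positive at every z ∈ K if a lies in the interior of Γ, and is identically 0 on K if a = a(c₁) or a = a(c₂). -/
open scoped ENNReal Classical

noncomputable section

namespace KilledRW

/-! ### Exit probabilities of a general kernel -/

theorem exitTotal_of_notMem (κ : Z2 → Z2 → ℝ≥0∞) {A : Set Z2} {z : Z2} (hz : z ∉ A) :
    exitTotal κ A z = 1 := by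
  unfold exitTotal
  rw [tsum_eq_single 0]
  · rw [tsum_eq_single z]
    · simp [exitP, hz]
    · intro w hw
      simp [exitP, hw]
  · intro n hn
    obtain ⟨m, rfl⟩ := Nat.exists_eq_succ_of_ne_zero hn
    simp [exitP, hz]

theorem tsum_exitP_succ (κ : Z2 → Z2 → ℝ≥0∞) {A : Set Z2} {z : Z2} (hz : z ∈ A) (n : ℕ) :
    ∑' z', exitP κ A (n + 1) z z' = ∑' w, κ z w * ∑' z', exitP κ A n w z' := by
  simp only [exitP, if_pos hz]
  rw [ENNReal.tsum_comm]
  simp only [ENNReal.tsum_mul_left]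

theorem tsum_exitP_zero (κ : Z2 → Z2 → ℝ≥0∞) {A : Set Z2} {z : Z2} (hz : z ∈ A) :
    ∑' z', exitP κ A 0 z z' = 0 := by
  simp [exitP, hz]

theorem exitTotal_of_mem (κ : Z2 → Z2 → ℝ≥0∞) {A : Set Z2} {z : Z2} (hz : z ∈ A) :
    exitTotal κ A z = ∑' w, κ z w * exitTotal κ A w := by
  have h1 : exitTotal κ A z = ∑' n, ∑' z', exitP κ A (n + 1) z z' := by
    rw [exitTotal, tsum_eq_zero_add' ENNReal.summable, tsum_exitP_zero κ hz, zero_add]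
  rw [h1]
  simp only [tsum_exitP_succ κ hz]
  rw [ENNReal.tsum_comm]
  simp only [ENNReal.tsum_mul_left, exitTotal]

/-- The exit probability is the smallest nonnegative function which is superharmonic on `A`
and at least `1` off `A`. -/
theorem exitTotal_le (κ : Z2 → Z2 → ℝ≥0∞) {A : Set Z2} (h : Z2 → ℝ≥0∞)
    (hA : ∀ z ∈ A, ∑' w, κ z w * h w ≤ h z) (hAc : ∀ z, z ∉ A → 1 ≤ h z) (z : Z2) :
    exitTotal κ A z ≤ h z := by
  by_cases hz : z ∉ A
  · rw [exitTotal_of_notMem κ hz]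
    exact hAc z hz
  refine ENNReal.tsum_le_of_sum_range_le fun N => ?_
  clear hz
  induction N generalizing z with
  | zero => simp
  | succ N ih =>
    by_cases hz : z ∈ A
    · rw [Finset.sum_range_succ', tsum_exitP_zero κ hz, add_zero]
      simp only [tsum_exitP_succ κ hz]
      rw [← Summable.tsum_finsetSum fun _ _ => ENNReal.summable]
      simp only [← Finset.mul_sum]
      exact (ENNReal.tsum_le_tsum fun w => by gcongr; exact ih w).trans (hA z hz)
    · refine le_trans ?_ (hAc z hz)
      rw [← exitTotal_of_notMem κ hz]
      exact ENNReal.sum_le_tsum _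

theorem exitTotal_le_one (κ : Z2 → Z2 → ℝ≥0∞) {A : Set Z2} (hκ : ∀ z, ∑' w, κ z w = 1) (z : Z2) :
    exitTotal κ A z ≤ 1 :=
  exitTotal_le κ (fun _ => 1) (fun z _ => by simp [hκ]) (fun _ _ => le_rfl) z

/-- If exit is not almost sure from `w`, it is not almost sure from any point from which the
killed walk reaches `w`; positivity of the transitions is read off a second kernel `κ'`. -/
theorem exitTotal_lt_one_of_aliveP {κ κ' : Z2 → Z2 → ℝ≥0∞} {A : Set Z2}
    (hκ : ∀ z, ∑' w, κ z w = 1) (hκκ' : ∀ z w, κ' z w ≠ 0 → κ z w ≠ 0) {w : Z2}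
    (hw : exitTotal κ A w < 1) (n : ℕ) (z : Z2) (hz : aliveP κ' A n z w ≠ 0) :
    exitTotal κ A z < 1 := by
  induction n generalizing z with
  | zero =>
    have : w = z := by
      by_contra hne
      simp [aliveP, hne] at hz
    rwa [← this]
  | succ n ih =>
    by_cases hzA : z ∈ A
    · simp only [aliveP, if_pos hzA, ne_eq, ENNReal.tsum_eq_zero, not_forall, mul_eq_zero,
        not_or] at hz
      obtain ⟨u, hu1, hu2⟩ := hz
      have hu := ih u hu2
      rw [exitTotal_of_mem κ hzA, ← hκ z]
      have hle : ∀ v, κ z v * exitTotal κ A v ≤ κ z v := fun v =>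
        mul_le_of_le_one_right' (exitTotal_le_one κ hκ v)
      have hfin : κ z u ≠ ∞ := ne_top_of_le_ne_top (hκ z ▸ ENNReal.one_ne_top)
        (ENNReal.le_tsum u)
      refine ENNReal.tsum_lt_tsum (i := u) ?_ hle ?_
      · exact ne_top_of_le_ne_top (hκ z ▸ ENNReal.one_ne_top) (ENNReal.tsum_le_tsum hle)
      · calc κ z u * exitTotal κ A u < κ z u * 1 :=
              ENNReal.mul_lt_mul_right (hκκ' z u hu1) hfin hu
          _ = κ z u := mul_one _
    · simp [aliveP, hzA] at hz

/-! ### Change of measure -/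

theorem dotR_sub_right (a x y : R2) : dotR a (x - y) = dotR a x - dotR a y := by
  simp only [dotR, Prod.fst_sub, Prod.snd_sub]; ring

theorem emb_sub (z w : Z2) : emb (z - w) = emb z - emb w := by
  simp [emb]

theorem emb_add (z w : Z2) : emb (z + w) = emb z + emb w := by
  simp [emb]

theorem dotR_add_right (a x y : R2) : dotR a (x + y) = dotR a x + dotR a y := by
  simp only [dotR, Prod.fst_add, Prod.snd_add]; ring

theorem dotR_add_left (a b x : R2) : dotR (a + b) x = dotR a x + dotR b x := by
  simp only [dotR, Prod.fst_add, Prod.snd_add]; ring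

theorem dotR_smul_left (s : ℝ) (a x : R2) : dotR (s • a) x = s * dotR a x := by
  simp only [dotR, Prod.smul_fst, Prod.smul_snd, smul_eq_mul]; ring

theorem dotR_smul_right (s : ℝ) (a x : R2) : dotR a (s • x) = s * dotR a x := by
  simp only [dotR, Prod.smul_fst, Prod.smul_snd, smul_eq_mul]; ring

theorem twKer_zero_mul_exp (γ : Z2 → ℝ) (a : R2) (z w : Z2) :
    twKer γ 0 z w * ENNReal.ofReal (Real.exp (dotR a (emb (w - z)))) = twKer γ a z w := by
  unfold twKer
  rw [← ENNReal.ofReal_mul' (Real.exp_pos _).le]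
  simp [dotR]

theorem exitP_twKer (γ : Z2 → ℝ) (a : R2) (A : Set Z2) (n : ℕ) (z z' : Z2) :
    exitP (twKer γ 0) A n z z' * ENNReal.ofReal (Real.exp (dotR a (emb (z' - z))))
      = exitP (twKer γ a) A n z z' := by
  induction n generalizing z with
  | zero =>
    by_cases h : z' = z
    · subst h
      simp [exitP, emb, dotR]
    · simp [exitP, h]
  | succ n ih =>
    by_cases hz : z ∈ A
    · simp only [exitP, if_pos hz]
      rw [← ENNReal.tsum_mul_right]
      refine tsum_congr fun w => ?_
      rw [← ih w, ← twKer_zero_mul_exp γ a z w]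
      have : Real.exp (dotR a (emb (z' - z)))
          = Real.exp (dotR a (emb (w - z))) * Real.exp (dotR a (emb (z' - w))) := by
        rw [← Real.exp_add, ← dotR_add_right, ← emb_add]
        congr 3
        abel
      rw [this, ENNReal.ofReal_mul (Real.exp_pos _).le]
      ring
    · simp [exitP, hz]

theorem exitLExp_eq_exitTotal (γ : Z2 → ℝ) (a : R2) (A : Set Z2) (z : Z2) :
    exitLExp (twKer γ 0) A z (fun z' => Real.exp (dotR a (emb (z' - z))))
      = exitTotal (twKer γ a) A z := by
  simp only [exitLExp, exitTotal, exitP_twKer]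

/-! ### Translation-invariant kernels -/

/-- The kernel of the random walk with step weights `p`. -/
def walkKer (p : Z2 → ℝ) (z w : Z2) : ℝ≥0∞ := ENNReal.ofReal (p (w - z))

theorem tsum_walkKer_mul (p : Z2 → ℝ) (z : Z2) (g : Z2 → ℝ≥0∞) :
    ∑' w, walkKer p z w * g w = ∑' y, ENNReal.ofReal (p y) * g (z + y) := by
  rw [← (Equiv.addLeft z).tsum_eq]
  simp [walkKer]

theorem tsum_walkKer_mul_ofReal {p : Z2 → ℝ} (hp0 : ∀ z, 0 ≤ p z) (z : Z2) {g : Z2 → ℝ}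
    (hg : ∀ z, 0 ≤ g z) (hs : Summable fun y => p y * g (z + y)) :
    ∑' w, walkKer p z w * ENNReal.ofReal (g w) = ENNReal.ofReal (∑' y, p y * g (z + y)) := by
  rw [tsum_walkKer_mul, ENNReal.ofReal_tsum_of_nonneg (fun y => mul_nonneg (hp0 y) (hg _)) hs]
  simp only [ENNReal.ofReal_mul (hp0 _)]

theorem tsum_walkKer {p : Z2 → ℝ} (hp0 : ∀ z, 0 ≤ p z) (hp1 : HasSum p 1) (z : Z2) :
    ∑' w, walkKer p z w = 1 := by
  have := tsum_walkKer_mul_ofReal hp0 z (g := fun _ => 1) (fun _ => zero_le_one)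
    (by simpa using hp1.summable)
  simpa [hp1.tsum_eq] using this

/-- A walk exits `A` almost surely if there is a nonnegative function `h` that decreases on
average by a uniform amount on each set `A ∩ {h < M}`. -/
theorem exitTotal_eq_one_of_lyapunov {p : Z2 → ℝ} (hp0 : ∀ z, 0 ≤ p z) (hp1 : HasSum p 1)
    {A : Set Z2} {h : Z2 → ℝ} (hh0 : ∀ z, 0 ≤ h z)
    (hs : ∀ z, Summable fun y => p y * h (z + y))
    (hdrift : ∀ M : ℝ, ∃ ε > 0, ∀ z ∈ A, h z < M → ∑' y, p y * h (z + y) ≤ h z - ε) (z : Z2) :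
    exitTotal (walkKer p) A z = 1 := by
  set v : Z2 → ℝ := fun z => 1 - (exitTotal (walkKer p) A z).toReal with hv
  have hE1 : ∀ z, exitTotal (walkKer p) A z ≤ 1 :=
    exitTotal_le_one _ (tsum_walkKer hp0 hp1)
  have hEtop : ∀ z, exitTotal (walkKer p) A z ≠ ∞ := fun z =>
    ne_top_of_le_ne_top ENNReal.one_ne_top (hE1 z)
  have hER : ∀ z, (exitTotal (walkKer p) A z).toReal ≤ 1 := fun z => by
    simpa using ENNReal.toReal_mono ENNReal.one_ne_top (hE1 z)
  have hv0 : ∀ z, 0 ≤ v z := fun z => sub_nonneg.2 (hER z)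
  have hv1 : ∀ z, v z ≤ 1 := fun z => sub_le_self _ ENNReal.toReal_nonneg
  have hsE : ∀ z, Summable fun y => p y * (exitTotal (walkKer p) A (z + y)).toReal := fun z =>
    Summable.of_nonneg_of_le (fun y => mul_nonneg (hp0 y) ENNReal.toReal_nonneg)
      (fun y => mul_le_of_le_one_right (hp0 y) (hER _)) hp1.summable
  have hvharm : ∀ z ∈ A, HasSum (fun y => p y * v (z + y)) (v z) := by
    intro z hz
    have h1 : (exitTotal (walkKer p) A z).toReal
        = ∑' y, p y * (exitTotal (walkKer p) A (z + y)).toReal := by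
      have := tsum_walkKer_mul_ofReal hp0 z
        (g := fun w => (exitTotal (walkKer p) A w).toReal) (fun _ => ENNReal.toReal_nonneg) (hsE z)
      simp only [ENNReal.ofReal_toReal (hEtop _)] at this
      rw [exitTotal_of_mem _ hz, this, ENNReal.toReal_ofReal
        (tsum_nonneg fun y => mul_nonneg (hp0 y) ENNReal.toReal_nonneg)]
    have h2 := hp1.sub (hsE z).hasSum
    rw [← h1] at h2
    refine h2.congr_fun ?_
    intro y
    simp only [hv]; ring
  have hvA : ∀ z, z ∉ A → v z = 0 := fun z hz => by
    simp [hv, exitTotal_of_notMem _ hz]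
  have key : ∀ δ > 0, ∀ z, v z ≤ δ * h z := by
    intro δ hδ
    by_contra! hcon
    obtain ⟨z₀, hz₀⟩ := hcon
    have hbdd : BddAbove (Set.range fun z => v z - δ * h z) :=
      ⟨1, by rintro _ ⟨z, rfl⟩; exact (sub_le_self _ (mul_nonneg hδ.le (hh0 z))).trans (hv1 z)⟩
    set s := ⨆ z, (v z - δ * h z) with hs_def
    have hle : ∀ z, v z - δ * h z ≤ s := fun z => le_ciSup hbdd z
    obtain ⟨ε, hε, hdr⟩ := hdrift (1 / δ)
    have hs0 : 0 < s := (sub_pos.2 hz₀).trans_le (hle z₀)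
    obtain ⟨x, hx⟩ := exists_lt_of_lt_ciSup (show max 0 (s - δ * ε) < s from
      max_lt hs0 (sub_lt_self _ (mul_pos hδ hε)))
    have hx0 := (le_max_left _ _).trans_lt hx
    have hx1 := (le_max_right _ _).trans_lt hx
    have hxA : x ∈ A := by
      by_contra hxA
      rw [hvA x hxA] at hx0
      nlinarith [hh0 x, mul_nonneg hδ.le (hh0 x)]
    have hhx : h x < 1 / δ := by
      rw [lt_div_iff₀ hδ]
      nlinarith [hv1 x]
    have h1 := hdr x hxA hhx
    have h2 : HasSum (fun y => p y * (v (x + y) - δ * h (x + y)))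
        (v x - δ * ∑' y, p y * h (x + y)) := by
      refine ((hvharm x hxA).sub ((hs x).hasSum.mul_left δ)).congr_fun fun y => ?_
      ring
    have h3 : v x - δ * ∑' y, p y * h (x + y) ≤ 1 * s :=
      hasSum_le (fun y => mul_le_mul_of_nonneg_left (hle _) (hp0 y)) h2 (hp1.mul_right s)
    nlinarith [mul_le_mul_of_nonneg_left h1 hδ.le]
  have hvz : v z ≤ 0 := by
    by_contra! hpos
    have h1 := key (v z / (2 * (h z + 1))) (by have := hh0 z; positivity) z
    have h2 : v z / (2 * (h z + 1)) * h z < v z := by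
      have := hh0 z
      rw [div_mul_eq_mul_div, div_lt_iff₀ (by positivity)]
      nlinarith
    linarith
  have : (exitTotal (walkKer p) A z).toReal = 1 := by
    have := hER z
    simp only [hv] at hvz
    linarith
  rw [← ENNReal.ofReal_toReal (hEtop z), this, ENNReal.ofReal_one]

/-! ### Real inequalities -/

theorem sqrt_one_add_le (u : ℝ) :
    Real.sqrt (1 + u) ≤ 1 + u / 2 - u ^ 2 / 8 + |u| ^ 3 / 8 := by
  rcases le_or_gt (1 + u) 0 with h | h
  · rw [Real.sqrt_eq_zero_of_nonpos h, abs_of_nonpos (by linarith)]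
    nlinarith [sq_nonneg (u + 2), mul_nonneg (sq_nonneg (u + 2)) (by linarith : 0 ≤ -u - 1)]
  · obtain ⟨s, hs, rfl⟩ : ∃ s : ℝ, 0 < s ∧ u = s ^ 2 - 1 :=
      ⟨Real.sqrt (1 + u), Real.sqrt_pos.2 h, by rw [Real.sq_sqrt h.le]; ring⟩
    rw [show 1 + (s ^ 2 - 1) = s ^ 2 by ring, Real.sqrt_sq hs.le]
    have h3 : 1 + (s ^ 2 - 1) / 2 - (s ^ 2 - 1) ^ 2 / 8 - s
        = -((s - 1) ^ 3 * (s + 3)) / 8 := by ring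
    rcases le_or_gt 1 s with h1 | h1
    · rw [abs_of_nonneg (by nlinarith)]
      have : 0 ≤ (s - 1) ^ 3 * ((s + 1) ^ 3 - (s + 3)) := by
        refine mul_nonneg (pow_nonneg (by linarith) 3) ?_
        nlinarith [pow_nonneg hs.le 3, mul_nonneg hs.le hs.le]
      nlinarith
    · have : 0 ≤ (1 - s) ^ 3 * (s + 3) :=
        mul_nonneg (pow_nonneg (by linarith) 3) (by linarith)
      have := pow_nonneg (abs_nonneg (s ^ 2 - 1)) 3
      nlinarith

theorem sqrt_add_le {y : ℝ} (hy : 0 < y) (x : ℝ) :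
    Real.sqrt (y + x) ≤ Real.sqrt y *
      (1 + (2 * y)⁻¹ * x - (8 * y ^ 2)⁻¹ * x ^ 2 + (8 * y ^ 3)⁻¹ * |x| ^ 3) := by
  have h : y + x = y * (1 + x / y) := by field_simp
  rw [h, Real.sqrt_mul hy.le]
  refine mul_le_mul_of_nonneg_left ((sqrt_one_add_le (x / y)).trans_eq ?_) (Real.sqrt_nonneg _)
  rw [abs_div, abs_of_pos hy]
  field_simp

theorem exp_neg_mul_le {t : ℝ} (ht0 : 0 ≤ t) (ht1 : t ≤ 1) (x : ℝ) :
    Real.exp (-t * x) ≤ 1 - t * x + t ^ 2 * (2 * Real.exp |2 * x|) := by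
  have h1 := Complex.norm_exp_sub_sum_le_norm_mul_exp ((-t * x : ℝ) : ℂ) 2
  rw [Finset.sum_range_succ, Finset.sum_range_one] at h1
  have h2 : Real.exp (-t * x) - (1 + -t * x) ≤ |(-t * x)| ^ 2 * Real.exp |(-t * x)| := by
    refine (le_abs_self _).trans ?_
    rw [Complex.norm_real, ← Complex.ofReal_exp] at h1
    have h4 : ((Real.exp (-t * x) : ℝ) : ℂ) - (((-t * x : ℝ) : ℂ) ^ 0 / (Nat.factorial 0 : ℕ)
        + ((-t * x : ℝ) : ℂ) ^ 1 / (Nat.factorial 1 : ℕ))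
        = ((Real.exp (-t * x) - (1 + -t * x) : ℝ) : ℂ) := by
      push_cast; simp
    rw [h4, Complex.norm_real] at h1
    exact h1
  have h3 : |(-t * x)| = t * |x| := by rw [abs_mul, abs_neg, abs_of_nonneg ht0]
  rw [h3] at h2
  have hx := abs_nonneg x
  have h5 : Real.exp (t * |x|) ≤ Real.exp |x| := Real.exp_le_exp.2 (by nlinarith)
  have h6 : |x| ^ 2 ≤ 2 * Real.exp |x| := by
    have := Real.pow_div_factorial_le_exp |x| hx 2
    norm_num [Nat.factorial] at this ⊢
    linarith
  have h7 : Real.exp |2 * x| = Real.exp |x| * Real.exp |x| := by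
    rw [← Real.exp_add, abs_mul]; norm_num; ring
  have h8 : (t * |x|) ^ 2 * Real.exp (t * |x|) ≤ t ^ 2 * (2 * Real.exp |2 * x|) := by
    rw [h7]
    calc (t * |x|) ^ 2 * Real.exp (t * |x|) = t ^ 2 * (|x| ^ 2 * Real.exp (t * |x|)) := by ring
      _ ≤ t ^ 2 * ((2 * Real.exp |x|) * Real.exp |x|) := by gcongr
      _ = _ := by ring
  linarith

/-! ### Step distributions with exponential moments -/

section Moments

variable {p : Z2 → ℝ}

theorem summable_mul_exp_abs (hp0 : ∀ z, 0 ≤ p z)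
    (hexp : ∀ b : R2, Summable fun z => p z * Real.exp (dotR b (emb z))) (b : R2) :
    Summable fun z => p z * Real.exp |dotR b (emb z)| := by
  refine Summable.of_nonneg_of_le (fun z => mul_nonneg (hp0 z) (Real.exp_pos _).le) (fun z => ?_)
    ((hexp b).add (hexp ((-1 : ℝ) • b)))
  rw [← mul_add]
  refine mul_le_mul_of_nonneg_left ?_ (hp0 z)
  rw [dotR_smul_left, neg_one_mul]
  rcases abs_choice (dotR b (emb z)) with h | h <;> rw [h] <;>
    linarith [Real.exp_pos (dotR b (emb z)), Real.exp_pos (-dotR b (emb z))]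

theorem summable_mul_abs_pow (hp0 : ∀ z, 0 ≤ p z)
    (hexp : ∀ b : R2, Summable fun z => p z * Real.exp (dotR b (emb z))) (b : R2) (k : ℕ) :
    Summable fun z => p z * |dotR b (emb z)| ^ k := by
  refine Summable.of_nonneg_of_le (fun z => mul_nonneg (hp0 z) (by positivity)) (fun z => ?_)
    ((summable_mul_exp_abs hp0 hexp b).mul_left (Nat.factorial k : ℝ))
  have h := Real.pow_div_factorial_le_exp _ (abs_nonneg (dotR b (emb z))) k
  rw [div_le_iff₀ (by positivity)] at h
  nlinarith [mul_le_mul_of_nonneg_left h (hp0 z)]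

theorem summable_mul_dotR (hp0 : ∀ z, 0 ≤ p z)
    (hexp : ∀ b : R2, Summable fun z => p z * Real.exp (dotR b (emb z))) (b : R2) :
    Summable fun z => p z * dotR b (emb z) := by
  refine Summable.of_abs ?_
  simpa [abs_mul, abs_of_nonneg (hp0 _)] using summable_mul_abs_pow hp0 hexp b 1

theorem hasSum_mul_dotR (hp0 : ∀ z, 0 ≤ p z)
    (hexp : ∀ b : R2, Summable fun z => p z * Real.exp (dotR b (emb z))) (b : R2) :
    HasSum (fun z => p z * dotR b (emb z))
      (dotR b (∑' z : Z2, p z * (z.1 : ℝ), ∑' z : Z2, p z * (z.2 : ℝ))) := by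
  have h1 : Summable fun z : Z2 => p z * (z.1 : ℝ) := by
    simpa [dotR, emb] using summable_mul_dotR hp0 hexp (1, 0)
  have h2 : Summable fun z : Z2 => p z * (z.2 : ℝ) := by
    simpa [dotR, emb] using summable_mul_dotR hp0 hexp (0, 1)
  refine ((h1.hasSum.mul_left b.1).add (h2.hasSum.mul_left b.2)).congr_fun fun z => ?_
  simp only [dotR, emb]; ring

/-- If the mean of `b · X` is positive, some small negative exponential moment is less
than `1`. -/
theorem exists_tsum_mul_exp_neg_lt_one (hp0 : ∀ z, 0 ≤ p z) (hp1 : HasSum p 1)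
    (hexp : ∀ b : R2, Summable fun z => p z * Real.exp (dotR b (emb z))) {b : R2} {m : ℝ}
    (hm : HasSum (fun z => p z * dotR b (emb z)) m) (hm0 : 0 < m) :
    ∃ t > 0, ∑' z, p z * Real.exp (-t * dotR b (emb z)) < 1 := by
  have hQ : Summable fun z => p z * (2 * Real.exp |2 * dotR b (emb z)|) := by
    have := (summable_mul_exp_abs hp0 hexp ((2 : ℝ) • b)).mul_left 2
    simp only [dotR_smul_left] at this
    exact this.congr fun z => by ring
  set Q := ∑' z, p z * (2 * Real.exp |2 * dotR b (emb z)|) with hQdef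
  have hQ0 : 0 ≤ Q := tsum_nonneg fun z => mul_nonneg (hp0 z) (by positivity)
  set t := min 1 (m / (Q + 1)) with ht
  have ht0 : 0 < t := lt_min one_pos (by positivity)
  have ht1 : t ≤ 1 := min_le_left _ _
  refine ⟨t, ht0, ?_⟩
  have h1 : HasSum (fun z => p z * (1 - t * dotR b (emb z)
      + t ^ 2 * (2 * Real.exp |2 * dotR b (emb z)|))) (1 - t * m + t ^ 2 * Q) := by
    refine ((hp1.sub (hm.mul_left t)).add (hQ.hasSum.mul_left (t ^ 2))).congr_fun fun z => ?_
    ring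
  have h2 : Summable fun z => p z * Real.exp (-t * dotR b (emb z)) := by
    simpa only [dotR_smul_left] using hexp ((-t) • b)
  have h3 := hasSum_le (fun z => mul_le_mul_of_nonneg_left
    (exp_neg_mul_le ht0.le ht1 (dotR b (emb z))) (hp0 z)) h2.hasSum h1
  have h4 : t * (Q + 1) ≤ m := by
    rw [← le_div_iff₀ (by positivity)]
    exact min_le_right _ _
  nlinarith

/-- A walk whose projection on `b` is centred and nondegenerate exits almost surely every set
contained in the half-plane `{b · x > 0}`. -/
theorem exitTotal_eq_one_of_centered (hp0 : ∀ z, 0 ≤ p z) (hp1 : HasSum p 1)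
    (hexp : ∀ b : R2, Summable fun z => p z * Real.exp (dotR b (emb z))) {b : R2}
    (hm : HasSum (fun z => p z * dotR b (emb z)) 0)
    (hnd : ∃ z, 0 < p z ∧ dotR b (emb z) ≠ 0) {A : Set Z2}
    (hA : ∀ z ∈ A, 0 < dotR b (emb z)) (z : Z2) : exitTotal (walkKer p) A z = 1 := by
  have hV : Summable fun z => p z * dotR b (emb z) ^ 2 := by
    simpa using summable_mul_abs_pow hp0 hexp b 2
  have hT := summable_mul_abs_pow hp0 hexp b 3
  set V := ∑' z, p z * dotR b (emb z) ^ 2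
  set T := ∑' z, p z * |dotR b (emb z)| ^ 3
  have hV0 : 0 < V := by
    obtain ⟨z₀, h1, h2⟩ := hnd
    exact hV.tsum_pos (fun z => mul_nonneg (hp0 z) (sq_nonneg _)) z₀ (by positivity)
  have hT0 : 0 ≤ T := tsum_nonneg fun z => mul_nonneg (hp0 z) (by positivity)
  set C := T / V + 1 with hC
  have hC1 : 1 ≤ C := by
    have : 0 ≤ T / V := by positivity
    linarith
  have hmaj : ∀ y : ℝ, HasSum (fun x => p x * (Real.sqrt y *
      (1 + (2 * y)⁻¹ * dotR b (emb x) - (8 * y ^ 2)⁻¹ * dotR b (emb x) ^ 2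
        + (8 * y ^ 3)⁻¹ * |dotR b (emb x)| ^ 3)))
      (Real.sqrt y * (1 + (2 * y)⁻¹ * 0 - (8 * y ^ 2)⁻¹ * V + (8 * y ^ 3)⁻¹ * T)) := by
    intro y
    refine ((((hp1.add (hm.mul_left (2 * y)⁻¹)).sub (hV.hasSum.mul_left (8 * y ^ 2)⁻¹)).add
      (hT.hasSum.mul_left (8 * y ^ 3)⁻¹)).mul_left (Real.sqrt y)).congr_fun fun x => ?_
    ring
  have hsum : ∀ y : ℝ, Summable fun x => p x * Real.sqrt (y + dotR b (emb x)) := by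
    intro y
    have h1 : (0 : ℝ) < |y| + 1 := by positivity
    refine Summable.of_nonneg_of_le (fun x => mul_nonneg (hp0 x) (Real.sqrt_nonneg _))
      (fun x => ?_) (hmaj (|y| + 1)).summable
    refine mul_le_mul_of_nonneg_left (le_trans (Real.sqrt_le_sqrt ?_) (sqrt_add_le h1 _)) (hp0 x)
    linarith [le_abs_self y]
  have hshift : ∀ z y : Z2, C + dotR b (emb (z + y))
      = (C + dotR b (emb z)) + dotR b (emb y) := fun z y => by
    rw [emb_add, dotR_add_right]; ring
  refine exitTotal_eq_one_of_lyapunov hp0 hp1 (h := fun z => Real.sqrt (C + dotR b (emb z)))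
    (fun z => Real.sqrt_nonneg _) (fun z => ?_) (fun M => ?_) z
  · simp only [hshift]
    exact hsum _
  · refine ⟨V / (8 * (M ^ 2 + 1) ^ 3), by positivity, fun x hx hxM => ?_⟩
    simp only [hshift]
    set y := C + dotR b (emb x) with hy
    have hyC : C ≤ y := by linarith [hA x hx]
    have hy0 : 0 < y := by linarith
    have hyM : y ≤ M ^ 2 + 1 := by
      have h1 := Real.sq_sqrt hy0.le
      have h2 := Real.sqrt_nonneg y
      nlinarith
    have h1 := hasSum_le (fun x => mul_le_mul_of_nonneg_left
      (sqrt_add_le hy0 (dotR b (emb x))) (hp0 x)) (hsum y).hasSum (hmaj y)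
    refine h1.trans ?_
    have h2 : Real.sqrt y * (1 + (2 * y)⁻¹ * 0 - (8 * y ^ 2)⁻¹ * V + (8 * y ^ 3)⁻¹ * T)
        = Real.sqrt y - Real.sqrt y * ((V * y - T) / (8 * y ^ 3)) := by
      field_simp
      ring
    rw [h2]
    have h3 : V ≤ V * y - T := by
      have : V * C = T + V := by rw [hC]; field_simp
      nlinarith
    have h4 : V / (8 * (M ^ 2 + 1) ^ 3) ≤ (V * y - T) / (8 * y ^ 3) := by
      have := hV0.le.trans h3
      gcongr
    have h5 : 1 ≤ Real.sqrt y := Real.one_le_sqrt.2 (by linarith)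
    have h6 : 0 ≤ V / (8 * (M ^ 2 + 1) ^ 3) := by positivity
    nlinarith

end Moments

theorem dotR_eq_of_nstep_ne_zero {p : Z2 → ℝ} {b : R2}
    (hb : ∀ z, 0 < p z → dotR b (emb z) = 0) (n : ℕ) (z z' : Z2)
    (h : nstep (walkKer p) n z z' ≠ 0) : dotR b (emb z') = dotR b (emb z) := by
  induction n generalizing z with
  | zero =>
    have : z' = z := by
      by_contra hne
      simp [nstep, hne] at h
    rw [this]
  | succ n ih =>
    simp only [nstep, ne_eq, ENNReal.tsum_eq_zero, not_forall, mul_eq_zero, not_or] at h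
    obtain ⟨w, h1, h2⟩ := h
    have h3 : 0 < p (w - z) := by
      simpa [walkKer] using h1
    have h4 := hb _ h3
    rw [emb_sub, dotR_sub_right] at h4
    rw [ih w h2]
    linarith

/-- A walk drifting into a finite intersection of half-planes survives with positive probability
from some multiple of any interior point. -/
theorem exists_exitTotal_nsmul_lt_one {ι : Type*} [Fintype ι] {p : Z2 → ℝ} (hp0 : ∀ z, 0 ≤ p z)
    (hp1 : HasSum p 1)
    (hexp : ∀ b : R2, Summable fun z => p z * Real.exp (dotR b (emb z))) {f : ι → R2}
    {m : ι → ℝ} (hm : ∀ i, HasSum (fun z => p z * dotR (f i) (emb z)) (m i))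
    (hm0 : ∀ i, 0 < m i) {z : Z2} (hz : ∀ i, 0 < dotR (f i) (emb z)) :
    ∃ n : ℕ, 0 < n ∧
      exitTotal (walkKer p) (emb ⁻¹' {x | ∀ i, 0 < dotR (f i) x}) (n • z) < 1 := by
  choose t ht0 ht1 using fun i => exists_tsum_mul_exp_neg_lt_one hp0 hp1 hexp (hm i) (hm0 i)
  set h : Z2 → ℝ := fun w => ∑ i, Real.exp (-t i * dotR (f i) (emb w)) with hh
  have hh0 : ∀ w, 0 ≤ h w := fun w => Finset.sum_nonneg fun i _ => (Real.exp_pos _).le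
  have hshift : ∀ (w : Z2) (i : ι), HasSum
      (fun y => p y * Real.exp (-t i * dotR (f i) (emb (w + y))))
      ((∑' y, p y * Real.exp (-t i * dotR (f i) (emb y)))
        * Real.exp (-t i * dotR (f i) (emb w))) := by
    intro w i
    have h2 : Summable fun y => p y * Real.exp (-t i * dotR (f i) (emb y)) := by
      simpa only [dotR_smul_left] using hexp ((-t i) • f i)
    refine (h2.hasSum.mul_right (Real.exp (-t i * dotR (f i) (emb w)))).congr_fun fun y => ?_
    rw [emb_add, dotR_add_right, mul_add, Real.exp_add]
    ring
  have hsum : ∀ w : Z2, HasSum (fun y => p y * h (w + y))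
      (∑ i, (∑' y, p y * Real.exp (-t i * dotR (f i) (emb y)))
        * Real.exp (-t i * dotR (f i) (emb w))) := by
    intro w
    refine (hasSum_sum fun i _ => hshift w i).congr_fun fun y => ?_
    simp only [hh, Finset.mul_sum]
  have hle := exitTotal_le (walkKer p) (A := emb ⁻¹' {x | ∀ i, 0 < dotR (f i) x})
    (fun w => ENNReal.ofReal (h w))
    (fun w _ => by
      rw [tsum_walkKer_mul_ofReal hp0 w hh0 (hsum w).summable, (hsum w).tsum_eq]
      exact ENNReal.ofReal_le_ofReal (Finset.sum_le_sum fun i _ =>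
        mul_le_of_le_one_left (Real.exp_pos _).le (ht1 i).le))
    (fun w hw => by
      simp only [Set.mem_preimage, Set.mem_ofPred_eq, not_forall, not_lt] at hw
      obtain ⟨i, hi⟩ := hw
      rw [← ENNReal.ofReal_one]
      refine ENNReal.ofReal_le_ofReal ((Real.one_le_exp ?_).trans
        (Finset.single_le_sum (f := fun i => Real.exp (-t i * dotR (f i) (emb w)))
          (fun i _ => (Real.exp_pos _).le) (Finset.mem_univ i)))
      nlinarith [ht0 i])
  have hlim : Filter.Tendsto (fun n : ℕ => h (n • z)) Filter.atTop (nhds 0) := by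
    have : ∀ i ∈ (Finset.univ : Finset ι), Filter.Tendsto
        (fun n : ℕ => Real.exp (-t i * dotR (f i) (emb (n • z)))) Filter.atTop (nhds 0) := by
      intro i _
      refine Real.tendsto_exp_atBot.comp ?_
      have h1 : ∀ n : ℕ, -t i * dotR (f i) (emb (n • z))
          = (n : ℝ) * (-(t i * dotR (f i) (emb z))) := fun n => by
        simp [emb, dotR]; ring
      simp only [h1]
      exact tendsto_natCast_atTop_atTop.atTop_mul_const_of_neg
        (neg_neg_of_pos (mul_pos (ht0 i) (hz i)))
    simpa only [Finset.sum_const_zero] using tendsto_finsetSum _ this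
  obtain ⟨n, hn1, hn0⟩ := ((hlim.eventually (gt_mem_nhds one_pos)).and
    (Filter.eventually_gt_atTop 0)).exists
  exact ⟨n, hn0, (hle _).trans_lt (by simpa using hn1)⟩

/-- **Lemma 6.** For `a ∈ Γ`, the function `z ↦ 1 − 𝔼_z[e^{a·(S(τ)−z)}; τ < ∞]` on `K`
is strictly positive at every `z ∈ K` if `a` lies in the interior of `Γ`
(i.e. `q(a) ∈ K`), and is identically `0` on `K` if `a = a(cᵢ)` (i.e. `q(a) = cᵢ`),
`i = 1, 2`. -/
theorem survival_prob_pos_iff_interior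
    (γ : Z2 → ℝ) (c f : Fin 2 → R2) (K : Set R2)
    -- `γ` is a probability distribution on `ℤ²`
    (hγ0 : ∀ z : Z2, 0 ≤ γ z) (hγ1 : HasSum γ 1)
    -- `c 0, c 1` are unit vectors, `f i` is the unit vector perpendicular to `c i`
    -- pointing into the cone; the angle between `c 0` and `c 1` lies in `(0, π)`
    (hcUnit : ∀ i, nrm (c i) = 1) (hfUnit : ∀ i, nrm (f i) = 1)
    (hperp : ∀ i, dotR (f i) (c i) = 0)
    (hinward : ∀ i j, i ≠ j → 0 < dotR (f i) (c j))
    -- `K` is the open convex cone bounded by the rays through `c 0` and `c 1`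
    (hK : K = {x : R2 | ∀ i, 0 < dotR (f i) x})
    -- (A1) the walk is irreducible with nonzero mean
    (hA1 : ∀ z z' : Z2, ∃ n : ℕ, 0 < nstep (twKer γ 0) n z z')
    (hmean : (∑' z : Z2, γ z * (z.1 : ℝ), ∑' z : Z2, γ z * (z.2 : ℝ)) ≠ (0, 0))
    -- (A2) the walk killed when leaving `K` is irreducible in `K`
    (hA2 : ∀ z z' : Z2, emb z ∈ K → emb z' ∈ K →
        ∃ n : ℕ, 0 < aliveP (twKer γ 0) (emb ⁻¹' K) n z z')
    -- (A3) the jump generating function is finite everywhere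
    (hA3 : ∀ a : R2, Summable fun z : Z2 => γ z * Real.exp (dotR a (emb z)))
    -- (A4) the projections `fᵢ·S(n)` are aperiodic random walks
    (hA4 : ∀ i : Fin 2, ∀ d : ℕ,
        (∀ n : ℕ, 0 < n →
          0 < ∑' z : Z2, (if dotR (f i) (emb z) = 0 then nstep (twKer γ 0) n 0 z else 0) →
          d ∣ n) → d = 1)
    -- `a ∈ Γ`
    (a : R2) (haD : jgf γ a = 1) (haq : qmap γ a ∈ closure K) :
    (qmap γ a ∈ K → ∀ z : Z2, emb z ∈ K →
        exitLExp (twKer γ 0) (emb ⁻¹' K) z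
          (fun z' => Real.exp (dotR a (emb (z' - z)))) < 1) ∧
    (∀ i : Fin 2, qmap γ a = c i → ∀ z : Z2, emb z ∈ K →
        exitLExp (twKer γ 0) (emb ⁻¹' K) z
          (fun z' => Real.exp (dotR a (emb (z' - z)))) = 1) := by
  set p : Z2 → ℝ := fun z => γ z * Real.exp (dotR a (emb z)) with hp
  have hker : twKer γ a = walkKer p := rfl
  have hp0 : ∀ z, 0 ≤ p z := fun z => mul_nonneg (hγ0 z) (Real.exp_pos _).le
  have hp1 : HasSum p 1 := haD ▸ (hA3 a).hasSum
  have hexp : ∀ b : R2, Summable fun z => p z * Real.exp (dotR b (emb z)) := fun b =>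
    (hA3 (a + b)).congr fun z => by
      simp only [hp]
      rw [dotR_add_left, Real.exp_add, mul_assoc]
  have hmean' : ∀ b : R2, HasSum (fun z => p z * dotR b (emb z)) (dotR b (gradJgf γ a)) :=
    hasSum_mul_dotR hp0 hexp
  have hq : ∀ b : R2, dotR b (qmap γ a)
      = (nrm (gradJgf γ a))⁻¹ * dotR b (gradJgf γ a) := fun b => dotR_smul_right _ _ _
  simp only [exitLExp_eq_exitTotal, hker]
  subst hK
  refine ⟨fun hqK z hz => ?_, fun i hqc z hz => ?_⟩
  · have hpos : ∀ i, 0 < dotR (f i) (gradJgf γ a) := fun i => by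
      have h1 := hqK i
      rw [hq] at h1
      exact pos_of_mul_pos_right h1 (inv_nonneg.2 (Real.sqrt_nonneg _))
    obtain ⟨n, hn, hlt⟩ := exists_exitTotal_nsmul_lt_one hp0 hp1 hexp
      (fun i => hmean' (f i)) hpos hz
    have hnz : emb (n • z) ∈ {x : R2 | ∀ i, 0 < dotR (f i) x} := fun i => by
      have h1 : emb (n • z) = (n : ℝ) • emb z := by simp [emb]
      rw [h1, dotR_smul_right]
      exact mul_pos (Nat.cast_pos.2 hn) (hz i)
    obtain ⟨k, hk⟩ := hA2 z (n • z) hz hnz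
    refine exitTotal_lt_one_of_aliveP (tsum_walkKer hp0 hp1) (fun u w huw => ?_) hlt k z hk.ne'
    rw [← hker, ← twKer_zero_mul_exp]
    exact mul_ne_zero huw (by simp [Real.exp_pos])
  · have hzero : dotR (f i) (gradJgf γ a) = 0 := by
      have h1 := hq (f i)
      rw [hqc, hperp i] at h1
      rcases mul_eq_zero.1 h1.symm with h | h
      · have h2 := hcUnit i
        rw [← hqc, qmap, h, zero_smul] at h2
        simp [nrm, dotR] at h2
      · exact h
    have hm := hmean' (f i)
    rw [hzero] at hm
    refine exitTotal_eq_one_of_centered hp0 hp1 hexp hm ?_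
      (A := emb ⁻¹' {x | ∀ i, 0 < dotR (f i) x}) (fun w hw => hw i) z
    by_contra! hdeg
    have hdeg0 : ∀ w, 0 < γ w → dotR (f i) (emb w) = 0 := fun w hw =>
      hdeg w (mul_pos hw (Real.exp_pos _))
    have hker0 : twKer γ 0 = walkKer γ := by
      funext u w
      simp [twKer, walkKer, dotR]
    have hall : ∀ w : Z2, dotR (f i) (emb w) = 0 := fun w => by
      obtain ⟨n, hn⟩ := hA1 0 w
      rw [hker0] at hn
      rw [dotR_eq_of_nstep_ne_zero hdeg0 n 0 w hn.ne']
      simp [emb, dotR]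
    exact (hz i).ne' (hall z)
end KilledRW
end
end
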